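/- For every even integer k ≥ 10, the graph G_k is perfect: for every subset S of the vertices of G_k, the clique number of the induced subgraph G_k[S] equals the chromatic number of G_k[S]. -/

import Mathlib

open SimpleGraph

/-- Vertex type of the graph `H_k`: four disjoint families
`b_i` (`i` mod `k`), `u_j` (`j` mod `3k`), `v_j` (`j` mod `3k`), `a_i` (`i` mod `k`). -/
inductive HkV (k : ℕ) : Type where
  | b : ZMod k → HkV k
  | u : ZMod (3 * k) → HkV k
  | v : ZMod (3 * k) → HkV k
  | a : ZMod k → HkV k
deriving DecidableEq

/-- The natural map sending the residue `i` mod `k` to the residue `3 i` mod `3 k`. -/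
def HkV.tr (k : ℕ) (i : ZMod k) : ZMod (3 * k) := 3 * (i.val : ZMod (3 * k))

/-- The base edge relation of `H_k`: the four cycles
`b_1 ⋯ b_k`, `u_1 ⋯ u_{3k}`, `v_1 ⋯ v_{3k}`, `a_1 ⋯ a_k`, together with the edges
`b_i u_{3i-2}`, `b_i u_{3i}`, `b_i u_{3i+2}`, the edges `u_j v_{j-1}`, `u_j v_{j+1}`,
and the edges `a_i v_{3i-2}`, `a_i v_{3i}`, `a_i v_{3i+2}` (indices modulo `k`
resp. `3k`). -/
def hkRel (k : ℕ) : HkV k → HkV k → Prop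
  | .b i, .b i' => i' = i + 1
  | .u j, .u j' => j' = j + 1
  | .v j, .v j' => j' = j + 1
  | .a i, .a i' => i' = i + 1
  | .b i, .u j => j = HkV.tr k i - 2 ∨ j = HkV.tr k i ∨ j = HkV.tr k i + 2
  | .u j, .v j' => j' = j - 1 ∨ j' = j + 1
  | .a i, .v j => j = HkV.tr k i - 2 ∨ j = HkV.tr k i ∨ j = HkV.tr k i + 2
  | _, _ => False

/-- The graph `H_k` from the paper. -/
def Hk (k : ℕ) : SimpleGraph (HkV k) := SimpleGraph.fromRel (hkRel k)
/-- The base edge relation of `G_k`: the relation of `H_k` on the old vertices, together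
with edges joining the new vertex (`none`) to `b_1, b_3, b_5, b_7, b_9`. -/
def gkRel (k : ℕ) : Option (HkV k) → Option (HkV k) → Prop
  | some x, some y => hkRel k x y
  | none, some (.b i) => i = 1 ∨ i = 3 ∨ i = 5 ∨ i = 7 ∨ i = 9
  | _, _ => False

/-- The graph `G_k` from the paper: `H_k` together with one new vertex `w = none` whose
neighborhood is exactly `{b_1, b_3, b_5, b_7, b_9}`. -/
def Gk (k : ℕ) : SimpleGraph (Option (HkV k)) := SimpleGraph.fromRel (gkRel k)

/-- In a `2`-colorable graph the clique number and the chromatic number agree. -/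
theorem SimpleGraph.Colorable.cliqueNum_eq_chromaticNumber_of_two {V : Type*}
    {G : SimpleGraph V} (h : G.Colorable 2) : (G.cliqueNum : ℕ∞) = G.chromaticNumber := by
  classical
  refine le_antisymm G.cliqueNum_le_chromaticNumber ?_
  have card_le {s : Finset V} (hs : G.IsClique s) : s.card ≤ G.cliqueNum :=
    le_csSup ⟨2, fun n ⟨t, ht⟩ => ht.card_eq ▸ ht.isClique.card_le_of_colorable h⟩
      ⟨s, hs, rfl⟩
  rcases isEmpty_or_nonempty V with hV | ⟨⟨x⟩⟩
  · simp [chromaticNumber_eq_zero_of_isEmpty]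
  by_cases hG : G = ⊥
  · have : Nonempty V := ⟨x⟩
    rw [chromaticNumber_eq_one_iff.2 ⟨hG, this⟩]
    exact_mod_cast card_le (s := {x}) (by simp)
  · obtain ⟨x, y, hxy⟩ := ne_bot_iff_exists_adj.1 hG
    refine h.chromaticNumber_le.trans ?_
    have hc := card_le (s := {x, y}) (by simpa using fun _ => hxy)
    rw [Finset.card_pair hxy.ne] at hc
    exact_mod_cast hc

/-- The bipartition of `G_k` for even `k`, given by parities of indices. -/
def gkColor (k : ℕ) (h : 2 ∣ k) : Option (HkV k) → ZMod 2
  | none => 0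
  | some (.b i) => ZMod.castHom h (ZMod 2) i
  | some (.u j) => ZMod.castHom (h.mul_left 3) (ZMod 2) j + 1
  | some (.v j) => ZMod.castHom (h.mul_left 3) (ZMod 2) j + 1
  | some (.a i) => ZMod.castHom h (ZMod 2) i

theorem castHom_tr (k : ℕ) [NeZero k] (h : 2 ∣ k) (i : ZMod k) :
    ZMod.castHom (h.mul_left 3) (ZMod 2) (HkV.tr k i) = ZMod.castHom h (ZMod 2) i := by
  conv_rhs => rw [← ZMod.natCast_zmod_val i]
  rw [HkV.tr, map_mul, map_natCast, map_natCast, map_ofNat,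
    show (OfNat.ofNat 3 : ZMod 2) = 1 from rfl, one_mul]

theorem gkColor_ne_of_gkRel (k : ℕ) [NeZero k] (h : 2 ∣ k) {x y : Option (HkV k)}
    (hxy : gkRel k x y) : gkColor k h x ≠ gkColor k h y := by
  have parity : ∀ c : ZMod 2, c ≠ c + 1 ∧ c + 1 ≠ c + 1 + 1 ∧ c ≠ c - 2 + 1 ∧ c ≠ c + 2 + 1 ∧
      c + 1 ≠ c - 1 + 1 := by decide
  rcases x with _ | ⟨i | i | i | i⟩ <;> rcases y with _ | ⟨j | j | j | j⟩ <;>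
    simp only [gkRel, hkRel] at hxy
  all_goals
    first
    | subst hxy
    | (rcases hxy with rfl | rfl | rfl | rfl | rfl)
  all_goals
    simp only [gkColor, map_add, map_sub, map_one, map_ofNat, castHom_tr k h]
    first
    | exact (parity _).1
    | exact (parity _).2.1
    | exact (parity _).2.2.1
    | exact (parity _).2.2.2.1
    | exact (parity _).2.2.2.2

theorem Gk_colorable_two (k : ℕ) [NeZero k] (h : 2 ∣ k) : (Gk k).Colorable 2 :=
  (Coloring.mk (G := Gk k) (gkColor k h) fun {_ _} hxy =>
    (((fromRel_adj _ _ _).1 hxy).2).elim (gkColor_ne_of_gkRel k h)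
      fun hyx => (gkColor_ne_of_gkRel k h hyx).symm).colorable

/-- for every even integer `k ≥ 10`, the graph `G_k` is perfect: for
every vertex subset `S`, the clique number of the induced subgraph `G_k[S]` equals
its chromatic number. -/
theorem Gk_perfect (k : ℕ) (hk : 10 ≤ k) (hke : Even k) :
    ∀ S : Set (Option (HkV k)),
      (((Gk k).induce S).cliqueNum : ℕ∞) = ((Gk k).induce S).chromaticNumber := by
  intro S
  have : NeZero k := ⟨by omega⟩
  exact ((Gk_colorable_two k hke.two_dvd).of_hom
    (Embedding.induce S).toHom).cliqueNum_eq_chromaticNumber_of_two
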